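/- Suppose the learning rate η = √(log(K)/(C_φ(π*;π_B)·n)) satisfies λ_min(V̄(π_B)) ≥ 2η·sup_{x,a} ‖φ(x,a)‖₂². Then for the comparator policy π* the expected regret of LinProd satisfies E[R(π*)] ≤ 2·√(C_φ(π*;π_B)·n·log K), where C_φ(π*;π_B) = Tr(V̄(π_B)^{-1}·V̄(π*)) is the feature coverage ratio. -/

import Mathlib

open MeasureTheory ProbabilityTheory Matrix

lemma lp_log_bound {x : ℝ} (hx : |x| ≤ 1 / 2) : x - x ^ 2 ≤ Real.log (1 + x) := by
  rw [abs_le] at hx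
  rcases le_or_gt 0 x with h | h
  · refine le_trans ?_ (Real.le_log_one_add_of_nonneg h)
    rw [le_div_iff₀ (by linarith)]
    nlinarith [pow_nonneg h 2, pow_nonneg h 3]
  · have hy : |-x| = -x := abs_of_pos (by linarith)
    have := Real.abs_log_sub_add_sum_range_le (x := -x) (by rw [hy]; linarith) 4
    rw [hy, abs_le] at this
    have h1 := this.1
    simp only [Finset.sum_range_succ, Finset.sum_range_zero] at h1
    norm_num at h1
    obtain ⟨y, rfl⟩ : ∃ y, x = -y := ⟨-x, by simp⟩
    have h2 : (- - y) ^ 5 / (1 + -y) ≤ y ^ 2 * (1 / 4) := by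
      rw [div_le_iff₀ (by linarith)]
      have hy0 : 0 < y := by linarith
      have hy1 : y ≤ 1 / 2 := by linarith
      have : y ^ 3 ≤ 1 / 8 := by
        calc y ^ 3 ≤ (1 / 2) ^ 3 := by gcongr
          _ = _ := by norm_num
      have h5 : (- - y) ^ 5 = y ^ 2 * y ^ 3 := by ring
      rw [h5, mul_assoc]
      gcongr
      linarith
    have hy0 : 0 < y := by linarith
    have hy1 : y ≤ 1 / 2 := by linarith
    have h3 : y ^ 3 ≤ y ^ 2 * (1 / 2) := by
      have : y ^ 3 = y ^ 2 * y := by ring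
      rw [this]; gcongr
    have h4 : y ^ 4 ≤ y ^ 2 * (1 / 4) := by
      have : y ^ 4 = y ^ 2 * (y * y) := by ring
      rw [this]; gcongr; nlinarith
    ring_nf at h1 h2 h3 h4 ⊢
    nlinarith [sq_nonneg y]

/-- The deterministic Prod bound. -/
lemma lp_prod {𝒜 : Type*} [Fintype 𝒜] [Nonempty 𝒜] (n : ℕ) (l : ℕ → 𝒜 → ℝ)
    (hl : ∀ t a, |l t a| ≤ 1 / 2) (p : 𝒜 → ℝ) (hp : ∀ a, 0 ≤ p a) (hp1 : ∑ a, p a = 1)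
    (w : ℕ → 𝒜 → ℝ) (hw : ∀ t a, w t a = ∏ k ∈ Finset.range t, (1 + l k a)) :
    ∑ t ∈ Finset.range n, ∑ a, (p a - w t a / ∑ a', w t a') * l t a
      ≤ Real.log (Fintype.card 𝒜) + ∑ t ∈ Finset.range n, ∑ a, p a * l t a ^ 2 := by
  have hpos1 : ∀ t a, 0 < 1 + l t a := fun t a => by
    have := (abs_le.1 (hl t a)).1; linarith
  have hwpos : ∀ t a, 0 < w t a := fun t a => by
    rw [hw]; exact Finset.prod_pos fun k _ => hpos1 k a
  have hWpos : ∀ t, 0 < ∑ a, w t a := fun t =>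
    Finset.sum_pos (fun a _ => hwpos t a) Finset.univ_nonempty
  have hup : ∀ m, Real.log (∑ a, w m a) ≤ Real.log (Fintype.card 𝒜)
      + ∑ t ∈ Finset.range m, ∑ a, w t a / (∑ a', w t a') * l t a := by
    intro m
    induction m with
    | zero => simp [hw]
    | succ m ih =>
      have h1 : ∑ a, w (m + 1) a
          = (∑ a, w m a) * (1 + ∑ a, w m a / (∑ a', w m a') * l m a) := by
        have : ∀ a, w (m + 1) a = w m a + w m a * l m a := fun a => by
          rw [hw, Finset.prod_range_succ, ← hw]; ring
        simp_rw [this, Finset.sum_add_distrib, mul_add, mul_one, Finset.mul_sum]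
        congr 1
        refine Finset.sum_congr rfl fun a _ => ?_
        have := (hWpos m).ne'
        field_simp
      have h2 : 0 < 1 + ∑ a, w m a / (∑ a', w m a') * l m a := by
        have := hWpos (m + 1)
        rw [h1] at this
        exact (mul_pos_iff_of_pos_left (hWpos m)).1 this
      rw [h1, Real.log_mul (hWpos m).ne' h2.ne', Finset.sum_range_succ]
      have := Real.log_le_sub_one_of_pos h2
      linarith
  have hlow : ∀ a, ∑ t ∈ Finset.range n, (l t a - l t a ^ 2) ≤ Real.log (∑ a, w n a) := by
    intro a
    calc ∑ t ∈ Finset.range n, (l t a - l t a ^ 2)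
        ≤ ∑ t ∈ Finset.range n, Real.log (1 + l t a) :=
          Finset.sum_le_sum fun t _ => lp_log_bound (hl t a)
      _ = Real.log (w n a) := by
          rw [hw, Real.log_prod]; intro k _; exact (hpos1 k a).ne'
      _ ≤ _ := Real.log_le_log (hwpos n a)
          (Finset.single_le_sum (fun a _ => (hwpos n a).le) (Finset.mem_univ a))
  have h3 : ∑ a, p a * ∑ t ∈ Finset.range n, (l t a - l t a ^ 2)
      ≤ Real.log (∑ a, w n a) := by
    calc _ ≤ ∑ a, p a * Real.log (∑ a, w n a) :=
          Finset.sum_le_sum fun a _ => mul_le_mul_of_nonneg_left (hlow a) (hp a)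
      _ = _ := by rw [← Finset.sum_mul, hp1, one_mul]
  have h4 := h3.trans (hup n)
  simp_rw [Finset.mul_sum] at h4
  rw [Finset.sum_comm] at h4
  simp_rw [sub_mul, mul_sub, Finset.sum_sub_distrib] at h4 ⊢
  linarith

lemma lp_eig {d : ℕ} (V : Matrix (Fin d) (Fin d) ℝ) (hH : V.IsHermitian) (c : ℝ)
    (hc : ∀ i, c ≤ hH.eigenvalues i) (y : Fin d → ℝ) : c * (y ⬝ᵥ y) ≤ y ⬝ᵥ V *ᵥ y := by
  have : (V - algebraMap ℝ (Matrix (Fin d) (Fin d) ℝ) c).PosSemidef := by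
    rw [posSemidef_iff_isHermitian_and_spectrum_nonneg]
    constructor
    · refine hH.sub ?_
      rw [Matrix.algebraMap_eq_diagonal]
      exact Matrix.isHermitian_diagonal _
    · rw [← spectrum.sub_singleton_eq, hH.spectrum_real_eq_range_eigenvalues]
      rintro _ ⟨_, ⟨i, rfl⟩, _, rfl, rfl⟩
      simpa using hc i
  have h := this.dotProduct_mulVec_nonneg y
  rw [Matrix.sub_mulVec, dotProduct_sub, Algebra.algebraMap_eq_smul_one, Matrix.smul_mulVec,
    Matrix.one_mulVec, dotProduct_smul] at h
  simp at h
  linarith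

/-- `|η uᵀ V⁻¹ v| ≤ 1/2`. -/
lemma lp_quad {d : ℕ} (V : Matrix (Fin d) (Fin d) ℝ) (hH : V.IsHermitian) (hdet : V.det ≠ 0)
    (hpsd : ∀ y, 0 ≤ y ⬝ᵥ V *ᵥ y) (η B : ℝ) (hη : 0 ≤ η)
    (hc : ∀ i, 2 * η * B ≤ hH.eigenvalues i) :
    (∀ u, 0 ≤ u ⬝ᵥ V⁻¹ *ᵥ u) ∧ (∀ u v, u ⬝ᵥ V⁻¹ *ᵥ v = v ⬝ᵥ V⁻¹ *ᵥ u) ∧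
    (∀ u v, u ⬝ᵥ u ≤ B → v ⬝ᵥ v ≤ B → |η * (u ⬝ᵥ V⁻¹ *ᵥ v)| ≤ 1 / 2) := by
  have hu : IsUnit V.det := hdet.isUnit
  have hVV : ∀ u, V *ᵥ (V⁻¹ *ᵥ u) = u := fun u => by
    rw [Matrix.mulVec_mulVec, Matrix.mul_nonsing_inv _ hu, Matrix.one_mulVec]
  have hsymm : V⁻¹ᵀ = V⁻¹ := by
    have := hH.inv
    simpa [Matrix.IsHermitian, Matrix.conjTranspose_eq_transpose_of_trivial] using this
  have h2 : ∀ u v, u ⬝ᵥ V⁻¹ *ᵥ v = v ⬝ᵥ V⁻¹ *ᵥ u := fun u v => by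
    rw [Matrix.dotProduct_mulVec, ← Matrix.mulVec_transpose, hsymm, dotProduct_comm]
  have h1 : ∀ u, 0 ≤ u ⬝ᵥ V⁻¹ *ᵥ u := fun u => by
    have := hpsd (V⁻¹ *ᵥ u)
    rwa [hVV, dotProduct_comm] at this
  refine ⟨h1, h2, fun u v hu hv => ?_⟩
  have h3 : ∀ u, u ⬝ᵥ u ≤ B → η * (u ⬝ᵥ V⁻¹ *ᵥ u) ≤ 1 / 2 := by
    intro u hu
    have ha := lp_eig V hH _ hc (V⁻¹ *ᵥ u)
    rw [hVV, dotProduct_comm _ u] at ha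
    set q := u ⬝ᵥ V⁻¹ *ᵥ u with hq
    have hcs : q ^ 2 ≤ (u ⬝ᵥ u) * ((V⁻¹ *ᵥ u) ⬝ᵥ (V⁻¹ *ᵥ u)) := by
      have := Finset.sum_mul_sq_le_sq_mul_sq Finset.univ u (V⁻¹ *ᵥ u)
      simpa [dotProduct, hq, sq] using this
    have hyy : 0 ≤ (V⁻¹ *ᵥ u) ⬝ᵥ (V⁻¹ *ᵥ u) :=
      Finset.sum_nonneg fun i _ => mul_self_nonneg _
    have hcs2 : q ^ 2 ≤ B * ((V⁻¹ *ᵥ u) ⬝ᵥ (V⁻¹ *ᵥ u)) :=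
      hcs.trans (mul_le_mul_of_nonneg_right hu hyy)
    have h4 : (2 * η * q) * q ≤ 1 * q := by
      have := mul_le_mul_of_nonneg_left hcs2 (by linarith : 0 ≤ 2 * η)
      nlinarith
    rcases (h1 u).eq_or_lt with h | h
    · rw [← hq] at h; rw [← h]; norm_num
    · have := le_of_mul_le_mul_right h4 h
      linarith
  have ha := h3 u hu
  have hb := h3 v hv
  have hp := h1 (u + v)
  have hm := h1 (u - v)
  simp only [Matrix.mulVec_add, Matrix.mulVec_sub, dotProduct_add, dotProduct_sub, add_dotProduct,
    sub_dotProduct, h2 v u] at hp hm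
  rw [abs_le]
  constructor <;> nlinarith

lemma lp_int {Ω : Type*} [MeasurableSpace Ω] (μ : Measure Ω) [IsFiniteMeasure μ] {f : Ω → ℝ}
    (hf : Measurable f) (C : ℝ) (hC : ∀ x, |f x| ≤ C) : Integrable f μ :=
  Integrable.of_bound hf.aestronglyMeasurable C (Filter.Eventually.of_forall hC)

lemma lp_law {Ω : Type*} [MeasurableSpace Ω] (μ : Measure Ω) [IsProbabilityMeasure μ]
    {𝒳 : Type*} [MeasurableSpace 𝒳] (ν : Measure 𝒳) [IsProbabilityMeasure ν]
    {𝒜 : Type*} [Fintype 𝒜] [DecidableEq 𝒜] [MeasurableSpace 𝒜] [MeasurableSingletonClass 𝒜]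
    (πB : 𝒳 → 𝒜 → ℝ) (h0 : ∀ x a, 0 ≤ πB x a) (h1 : ∀ x, ∑ a, πB x a = 1)
    (hm : ∀ a, Measurable fun x => πB x a)
    (X : Ω → 𝒳) (A : Ω → 𝒜) (hX : Measurable X) (hA : Measurable A)
    (h_law : ∀ (S : Set 𝒳), MeasurableSet S → ∀ a,
      μ {ω | X ω ∈ S ∧ A ω = a} = ∫⁻ x in S, ENNReal.ofReal (πB x a) ∂ν)
    (g : 𝒳 × 𝒜 → ℝ) (hg : Measurable g) (C : ℝ) (hC : ∀ z, |g z| ≤ C) :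
    ∫ ω, g (X ω, A ω) ∂μ = ∫ x, ∑ a, πB x a * g (x, a) ∂ν := by
  have hle : ∀ x a, πB x a ≤ 1 := fun x a => by
    rw [← h1 x]; exact Finset.single_le_sum (fun a _ => h0 x a) (Finset.mem_univ a)
  have hga : ∀ a, Measurable fun x => g (x, a) := fun a => by fun_prop
  have hms : ∀ a, MeasurableSet {ω | A ω = a} := fun a => hA (measurableSet_singleton a)
  have e1 : ∀ ω, g (X ω, A ω) = ∑ a, Set.indicator {ω | A ω = a} (fun ω => g (X ω, a)) ω := by
    intro ω
    rw [Finset.sum_eq_single (A ω)]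
    · simp
    · intro b _ hb
      simp [Set.indicator, hb.symm]
    · simp
  have hmap : ∀ a, (μ.restrict {ω | A ω = a}).map X
      = ν.withDensity (fun x => ENNReal.ofReal (πB x a)) := by
    intro a
    ext S hS
    rw [Measure.map_apply hX hS, Measure.restrict_apply (hX hS), withDensity_apply _ hS,
      ← h_law S hS a]
    rfl
  simp_rw [e1]
  rw [integral_finsetSum, integral_finsetSum]
  · refine Finset.sum_congr rfl fun a _ => ?_
    rw [integral_indicator (hms a), ← integral_map (f := fun x => g (x, a)) hX.aemeasurable
      (hga a).aestronglyMeasurable, hmap,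
      integral_withDensity_eq_integral_toReal_smul (hm a).ennreal_ofReal
        (Filter.Eventually.of_forall fun x => ENNReal.ofReal_lt_top)]
    refine integral_congr_ae (Filter.Eventually.of_forall fun x => ?_)
    simp [ENNReal.toReal_ofReal (h0 x a)]
  · intro a _
    refine lp_int ν ((hm a).mul (hga a)) C fun x => ?_
    rw [abs_mul, abs_of_nonneg (h0 x a)]
    calc _ ≤ 1 * |g (x, a)| := by gcongr; exact hle x a
      _ ≤ C := by rw [one_mul]; exact hC _
  · intro a _
    exact (lp_int μ ((hga a).comp hX) C fun x => hC _).indicator (hms a)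

lemma lp_indep {Ω : Type*} [MeasurableSpace Ω] (μ : Measure Ω) [IsProbabilityMeasure μ]
    {E F : Type*} [MeasurableSpace E] [MeasurableSpace F] (H : Ω → E) (Z : Ω → F)
    (hH : Measurable H) (hZ : Measurable Z) (hi : IndepFun H Z μ)
    (f : E × F → ℝ) (hf : Measurable f) (C : ℝ) (hC : ∀ z, |f z| ≤ C) :
    ∫ ω, f (H ω, Z ω) ∂μ = ∫ ω, ∫ ω', f (H ω, Z ω') ∂μ ∂μ := by
  have := Measure.isProbabilityMeasure_map (μ := μ) hH.aemeasurable
  have := Measure.isProbabilityMeasure_map (μ := μ) hZ.aemeasurable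
  have e1 : ∫ ω, f (H ω, Z ω) ∂μ = ∫ p, f p ∂(μ.map fun ω => (H ω, Z ω)) :=
    (integral_map (hH.prodMk hZ).aemeasurable hf.aestronglyMeasurable).symm
  rw [e1, hi.map_prod_eq_prod_map_map hH.aemeasurable hZ.aemeasurable,
    integral_prod _ (lp_int _ hf C hC), integral_map hH.aemeasurable]
  · refine integral_congr_ae (Filter.Eventually.of_forall fun ω => ?_)
    exact integral_map hZ.aemeasurable (hf.comp measurable_prodMk_left).aestronglyMeasurable
  · exact hf.stronglyMeasurable.integral_prod_right'.aestronglyMeasurable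

lemma lp_ent {𝒳 : Type*} [MeasurableSpace 𝒳] (ν : Measure 𝒳) [IsProbabilityMeasure ν]
    {𝒜 : Type*} [Fintype 𝒜] {d : ℕ} (φ : 𝒳 → 𝒜 → (Fin d → ℝ))
    (hφ_meas : ∀ a i, Measurable fun x => φ x a i)
    (B : ℝ) (hB : ∀ x a, ∑ i, φ x a i ^ 2 ≤ B)
    (p : 𝒳 → 𝒜 → ℝ) (h0 : ∀ x a, 0 ≤ p x a) (h1 : ∀ x, ∑ a, p x a = 1)
    (hm : ∀ a, Measurable fun x => p x a) (i j : Fin d) :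
    Integrable (fun x => ∑ a, p x a * (φ x a i * φ x a j)) ν := by
  have hle : ∀ x a, p x a ≤ 1 := fun x a => by
    rw [← h1 x]; exact Finset.single_le_sum (fun a _ => h0 x a) (Finset.mem_univ a)
  have hs : ∀ x a i, φ x a i ^ 2 ≤ B := fun x a i =>
    (Finset.single_le_sum (f := fun i => φ x a i ^ 2) (fun i _ => sq_nonneg _)
      (Finset.mem_univ i)).trans (hB x a)
  refine integrable_finsetSum _ fun a _ => lp_int ν
    ((hm a).mul ((hφ_meas a i).mul (hφ_meas a j))) B fun x => ?_
  rw [abs_mul, abs_of_nonneg (h0 x a)]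
  calc _ ≤ 1 * |φ x a i * φ x a j| := by gcongr; exact hle x a
    _ ≤ B := by
      rw [one_mul, abs_le]
      have ha := hs x a i
      have hb := hs x a j
      constructor <;> nlinarith [sq_nonneg (φ x a i + φ x a j), sq_nonneg (φ x a i - φ x a j)]

/-- Linear functionals of the second moment matrix. -/
lemma lp_lin {𝒳 : Type*} [MeasurableSpace 𝒳] (ν : Measure 𝒳) [IsProbabilityMeasure ν]
    {𝒜 : Type*} [Fintype 𝒜] {d : ℕ} (φ : 𝒳 → 𝒜 → (Fin d → ℝ))
    (hφ_meas : ∀ a i, Measurable fun x => φ x a i)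
    (B : ℝ) (hB : ∀ x a, ∑ i, φ x a i ^ 2 ≤ B)
    (p : 𝒳 → 𝒜 → ℝ) (h0 : ∀ x a, 0 ≤ p x a) (h1 : ∀ x, ∑ a, p x a = 1)
    (hm : ∀ a, Measurable fun x => p x a) (M : Fin d → Fin d → ℝ) :
    Integrable (fun x => ∑ a, p x a * ∑ i, ∑ j, M i j * (φ x a i * φ x a j)) ν ∧
    ∫ x, ∑ a, p x a * ∑ i, ∑ j, M i j * (φ x a i * φ x a j) ∂ν
      = ∑ i, ∑ j, M i j * ∫ x, ∑ a, p x a * (φ x a i * φ x a j) ∂ν := by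
  have hI := lp_ent ν φ hφ_meas B hB p h0 h1 hm
  have e : (fun x => ∑ a, p x a * ∑ i, ∑ j, M i j * (φ x a i * φ x a j))
      = fun x => ∑ i, ∑ j, M i j * ∑ a, p x a * (φ x a i * φ x a j) := by
    funext x
    simp_rw [Finset.mul_sum]
    rw [Finset.sum_comm]
    refine Finset.sum_congr rfl fun i _ => ?_
    rw [Finset.sum_comm]
    refine Finset.sum_congr rfl fun j _ => Finset.sum_congr rfl fun a _ => by ring
  rw [e]
  constructor
  · exact integrable_finsetSum _ fun i _ => integrable_finsetSum _ fun j _ => (hI i j).const_mul _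
  · rw [integral_finsetSum _ fun i _ => integrable_finsetSum _ fun j _ => (hI i j).const_mul _]
    refine Finset.sum_congr rfl fun i _ => ?_
    rw [integral_finsetSum _ fun j _ => (hI i j).const_mul _]
    exact Finset.sum_congr rfl fun j _ => integral_const_mul _ _

lemma lp_moment {𝒳 : Type*} [MeasurableSpace 𝒳] (ν : Measure 𝒳) [IsProbabilityMeasure ν]
    {𝒜 : Type*} [Fintype 𝒜] {d : ℕ} (φ : 𝒳 → 𝒜 → (Fin d → ℝ))
    (hφ_meas : ∀ a i, Measurable fun x => φ x a i)
    (B : ℝ) (hB : ∀ x a, ∑ i, φ x a i ^ 2 ≤ B)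
    (p : 𝒳 → 𝒜 → ℝ) (h0 : ∀ x a, 0 ≤ p x a) (h1 : ∀ x, ∑ a, p x a = 1)
    (hm : ∀ a, Measurable fun x => p x a) (V : Matrix (Fin d) (Fin d) ℝ)
    (hV : ∀ i j, V i j = ∫ x, ∑ a, p x a * (φ x a i * φ x a j) ∂ν) (u v : Fin d → ℝ) :
    Integrable (fun x => ∑ a, p x a * ((φ x a ⬝ᵥ u) * (φ x a ⬝ᵥ v))) ν ∧
    ∫ x, ∑ a, p x a * ((φ x a ⬝ᵥ u) * (φ x a ⬝ᵥ v)) ∂ν = u ⬝ᵥ V *ᵥ v := by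
  have h := lp_lin ν φ hφ_meas B hB p h0 h1 hm (fun i j => u i * v j)
  have e : ∀ x a, (φ x a ⬝ᵥ u) * (φ x a ⬝ᵥ v)
      = ∑ i, ∑ j, u i * v j * (φ x a i * φ x a j) := by
    intro x a
    simp_rw [dotProduct, Finset.sum_mul_sum]
    exact Finset.sum_congr rfl fun i _ => Finset.sum_congr rfl fun j _ => by ring
  simp_rw [e]
  refine ⟨h.1, h.2.trans ?_⟩
  simp_rw [dotProduct, mulVec, dotProduct, Finset.mul_sum, hV]
  exact Finset.sum_congr rfl fun i _ => Finset.sum_congr rfl fun j _ => by ring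

lemma lp_trace {𝒳 : Type*} [MeasurableSpace 𝒳] (ν : Measure 𝒳) [IsProbabilityMeasure ν]
    {𝒜 : Type*} [Fintype 𝒜] {d : ℕ} (φ : 𝒳 → 𝒜 → (Fin d → ℝ))
    (hφ_meas : ∀ a i, Measurable fun x => φ x a i)
    (B : ℝ) (hB : ∀ x a, ∑ i, φ x a i ^ 2 ≤ B)
    (p : 𝒳 → 𝒜 → ℝ) (h0 : ∀ x a, 0 ≤ p x a) (h1 : ∀ x, ∑ a, p x a = 1)
    (hm : ∀ a, Measurable fun x => p x a) (V : Matrix (Fin d) (Fin d) ℝ)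
    (hV : ∀ i j, V i j = ∫ x, ∑ a, p x a * (φ x a i * φ x a j) ∂ν)
    (M : Matrix (Fin d) (Fin d) ℝ) :
    Integrable (fun x => ∑ a, p x a * (φ x a ⬝ᵥ M *ᵥ φ x a)) ν ∧
    ∫ x, ∑ a, p x a * (φ x a ⬝ᵥ M *ᵥ φ x a) ∂ν = (M * V).trace := by
  have h := lp_lin ν φ hφ_meas B hB p h0 h1 hm M
  have e : ∀ x a, φ x a ⬝ᵥ M *ᵥ φ x a
      = ∑ i, ∑ j, M i j * (φ x a i * φ x a j) := by
    intro x a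
    simp_rw [dotProduct, mulVec, dotProduct, Finset.mul_sum]
    exact Finset.sum_congr rfl fun i _ => Finset.sum_congr rfl fun j _ => by ring
  simp_rw [e]
  refine ⟨h.1, h.2.trans ?_⟩
  simp_rw [Matrix.trace, Matrix.diag, Matrix.mul_apply]
  refine Finset.sum_congr rfl fun i _ => Finset.sum_congr rfl fun j _ => ?_
  rw [hV j i]
  simp_rw [mul_comm (φ _ _ j)]

noncomputable def lpL {𝒳 𝒜 : Type*} {d : ℕ} (φ : 𝒳 → 𝒜 → (Fin d → ℝ))
    (V : Matrix (Fin d) (Fin d) ℝ) (θ : ℕ → Fin d → ℝ) (k : ℕ) (z : 𝒳 × 𝒜) (x : 𝒳) (a : 𝒜) : ℝ :=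
  (φ z.1 z.2 ⬝ᵥ V⁻¹ *ᵥ φ x a) * (φ z.1 z.2 ⬝ᵥ θ k)

noncomputable def lpW {𝒳 𝒜 : Type*} {d : ℕ} (φ : 𝒳 → 𝒜 → (Fin d → ℝ))
    (V : Matrix (Fin d) (Fin d) ℝ) (θ : ℕ → Fin d → ℝ) (η : ℝ) (t : ℕ)
    (h : Finset.range t → 𝒳 × 𝒜) (x : 𝒳) (a : 𝒜) : ℝ :=
  ∏ k : Finset.range t, (1 + η * lpL φ V θ k (h k) x a)

noncomputable def lpP {𝒳 𝒜 : Type*} [Fintype 𝒜] {d : ℕ} (φ : 𝒳 → 𝒜 → (Fin d → ℝ))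
    (V : Matrix (Fin d) (Fin d) ℝ) (θ : ℕ → Fin d → ℝ) (η : ℝ) (t : ℕ)
    (h : Finset.range t → 𝒳 × 𝒜) (x : 𝒳) (a : 𝒜) : ℝ :=
  lpW φ V θ η t h x a / ∑ a', lpW φ V θ η t h x a'

lemma lpL_meas {𝒳 𝒜 : Type*} [MeasurableSpace 𝒳] [Fintype 𝒜] [MeasurableSpace 𝒜]
    [MeasurableSingletonClass 𝒜] {d : ℕ} (φ : 𝒳 → 𝒜 → (Fin d → ℝ))
    (hφ_meas : ∀ a i, Measurable fun x => φ x a i)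
    (V : Matrix (Fin d) (Fin d) ℝ) (θ : ℕ → Fin d → ℝ) (k : ℕ) (a : 𝒜) :
    Measurable fun p : (𝒳 × 𝒜) × 𝒳 => lpL φ V θ k p.1 p.2 a := by
  have h1 : ∀ i, Measurable fun z : 𝒳 × 𝒜 => φ z.1 z.2 i := fun i =>
    measurable_from_prod_countable_left fun a => hφ_meas a i
  have h1' : ∀ i, Measurable fun p : (𝒳 × 𝒜) × 𝒳 => φ p.1.1 p.1.2 i := fun i =>
    (h1 i).comp measurable_fst
  have h2 : ∀ i, Measurable fun p : (𝒳 × 𝒜) × 𝒳 => φ p.2 a i := fun i =>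
    (hφ_meas a i).comp measurable_snd
  unfold lpL
  simp only [dotProduct, mulVec]
  refine Measurable.mul ?_ ?_
  · exact Finset.measurable_fun_sum _ fun i _ => (h1' i).mul
      (Finset.measurable_fun_sum _ fun j _ => (h2 j).const_mul _)
  · exact Finset.measurable_fun_sum _ fun i _ => (h1' i).mul_const _

lemma lpP_meas {𝒳 𝒜 : Type*} [MeasurableSpace 𝒳] [Fintype 𝒜] [MeasurableSpace 𝒜]
    [MeasurableSingletonClass 𝒜] {d : ℕ} (φ : 𝒳 → 𝒜 → (Fin d → ℝ))
    (hφ_meas : ∀ a i, Measurable fun x => φ x a i)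
    (V : Matrix (Fin d) (Fin d) ℝ) (θ : ℕ → Fin d → ℝ) (η : ℝ) (t : ℕ) (a : 𝒜) :
    Measurable fun p : (Finset.range t → 𝒳 × 𝒜) × 𝒳 => lpP φ V θ η t p.1 p.2 a := by
  have hW : ∀ a, Measurable fun p : (Finset.range t → 𝒳 × 𝒜) × 𝒳 =>
      lpW φ V θ η t p.1 p.2 a := by
    intro a
    unfold lpW
    refine Finset.measurable_fun_prod _ fun k _ => ?_
    refine Measurable.const_add (Measurable.const_mul ?_ _) _
    have hk : Measurable fun p : (Finset.range t → 𝒳 × 𝒜) × 𝒳 => (p.1 k, p.2) := by fun_prop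
    exact (lpL_meas φ hφ_meas V θ k a).comp hk
  exact (hW a).div (Finset.measurable_fun_sum _ fun a _ => hW a)

/-- Theorem 3, coverage-dependent tuning: if the learning rate
`η = √(log(K)/(C_φ(π*;π_B)·n))` satisfies `λ_min(V̄(π_B)) ≥ 2η·sup_{x,a}‖φ(x,a)‖₂²`,
then the expected regret of LinProd against the comparator `π*` is bounded by
`2·√(C_φ(π*;π_B)·n·log K)`, where `C_φ(π*;π_B) = Tr(V̄(π_B)⁻¹·V̄(π*))`. -/
theorem linprod_regret_coverage_tuning
    {Ω : Type*} [MeasurableSpace Ω] (μ : Measure Ω) [IsProbabilityMeasure μ]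
    {𝒳 : Type*} [MeasurableSpace 𝒳] (ν : Measure 𝒳) [IsProbabilityMeasure ν]
    {𝒜 : Type*} [Fintype 𝒜] [DecidableEq 𝒜] [MeasurableSpace 𝒜] [MeasurableSingletonClass 𝒜]
    (K : ℕ) (hK : K = Fintype.card 𝒜) (hK2 : 2 ≤ K)
    (d : ℕ) (φ : 𝒳 → 𝒜 → (Fin d → ℝ))
    (hφ_meas : ∀ a i, Measurable fun x => φ x a i)
    (B : ℝ) (hB : ∀ x a, ∑ i, φ x a i ^ 2 ≤ B)
    (n : ℕ) (hn : 0 < n) (θ : ℕ → Fin d → ℝ)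
    (hθ : ∀ t x a, (∑ i, θ t i * φ x a i) ∈ Set.Icc (0 : ℝ) 1)
    (πB : 𝒳 → 𝒜 → ℝ) (hπB_nonneg : ∀ x a, 0 ≤ πB x a) (hπB_sum : ∀ x, ∑ a, πB x a = 1)
    (hπB_meas : ∀ a, Measurable fun x => πB x a)
    (πstar : 𝒳 → 𝒜 → ℝ) (hπstar_nonneg : ∀ x a, 0 ≤ πstar x a)
    (hπstar_sum : ∀ x, ∑ a, πstar x a = 1)
    (hπstar_meas : ∀ a, Measurable fun x => πstar x a)
    (Vbar : (𝒳 → 𝒜 → ℝ) → Matrix (Fin d) (Fin d) ℝ)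
    (hVbar : ∀ π i j, Vbar π i j = ∫ x, ∑ a, π x a * (φ x a i * φ x a j) ∂ν)
    (hdet : (Vbar πB).det ≠ 0)
    (hHerm : (Vbar πB).IsHermitian)
    (Cφ : ℝ) (hCφ : Cφ = Matrix.trace ((Vbar πB)⁻¹ * Vbar πstar))
    (η : ℝ) (hη : η = Real.sqrt (Real.log K / (Cφ * n)))
    (hlammin : ∀ i, 2 * η * B ≤ hHerm.eigenvalues i)
    (X : ℕ → Ω → 𝒳) (AB : ℕ → Ω → 𝒜)
    (hX_meas : ∀ t, Measurable (X t)) (hAB_meas : ∀ t, Measurable (AB t))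
    (h_indep : iIndepFun (fun t ω => (X t ω, AB t ω)) μ)
    (h_law : ∀ t (S : Set 𝒳), MeasurableSet S → ∀ a,
      μ {ω | X t ω ∈ S ∧ AB t ω = a} = ∫⁻ x in S, ENNReal.ofReal (πB x a) ∂ν)
    (RB : ℕ → Ω → ℝ) (hRB : ∀ t ω, RB t ω = ∑ i, θ t i * φ (X t ω) (AB t ω) i)
    (θhat : ℕ → Ω → Fin d → ℝ)
    (hθhat : ∀ t ω,
      θhat t ω = (Vbar πB)⁻¹.mulVec fun i => φ (X t ω) (AB t ω) i * RB t ω)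
    (w : ℕ → 𝒳 → 𝒜 → Ω → ℝ)
    (hw : ∀ t x a ω,
      w t x a ω = ∏ k ∈ Finset.range t, (1 + η * ∑ i, θhat k ω i * φ x a i))
    (pol : ℕ → 𝒳 → 𝒜 → Ω → ℝ)
    (hpol : ∀ t x a ω, pol t x a ω = w t x a ω / ∑ a', w t x a' ω) :
    (∫ ω, ∑ t ∈ Finset.range n, ∑ a,
        (πstar (X t ω) a - pol t (X t ω) a ω) * (∑ i, θ t i * φ (X t ω) a i) ∂μ) ≤
      2 * Real.sqrt (Cφ * n * Real.log K) := by
  classical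
  have hne : Nonempty 𝒜 := Fintype.card_pos_iff.1 (by omega)
  have hnX : Nonempty 𝒳 := by
    by_contra h
    rw [not_nonempty_iff] at h
    have h1 : ν Set.univ = 1 := measure_univ
    rw [Set.univ_eq_empty_iff.2 h] at h1
    simp at h1
  have hη0 : 0 ≤ η := by rw [hη]; exact Real.sqrt_nonneg _
  set V := Vbar πB with hV
  have hmom := lp_moment ν φ hφ_meas B hB πB hπB_nonneg hπB_sum hπB_meas V (hVbar πB)
  have hpsd : ∀ y, 0 ≤ y ⬝ᵥ V *ᵥ y := fun y => by
    rw [← (hmom y y).2]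
    exact integral_nonneg fun x => Finset.sum_nonneg fun a _ =>
      mul_nonneg (hπB_nonneg x a) (mul_self_nonneg _)
  obtain ⟨hQ0, hQs, hQb⟩ := lp_quad V hHerm hdet hpsd η B hη0 hlammin
  have hVV : ∀ u, V *ᵥ (V⁻¹ *ᵥ u) = u := fun u => by
    rw [Matrix.mulVec_mulVec, Matrix.mul_nonsing_inv _ hdet.isUnit, Matrix.one_mulVec]
  have hVV' : ∀ u, V⁻¹ *ᵥ (V *ᵥ u) = u := fun u => by
    rw [Matrix.mulVec_mulVec, Matrix.nonsing_inv_mul _ hdet.isUnit, Matrix.one_mulVec]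
  have hφB : ∀ x a, φ x a ⬝ᵥ φ x a ≤ B := fun x a => by
    have := hB x a
    simpa [dotProduct, sq] using this
  -- rewards
  have hr : ∀ t x a, (∑ i, θ t i * φ x a i) = φ x a ⬝ᵥ θ t := fun t x a => by
    rw [dotProduct_comm]; rfl
  simp_rw [hr] at hθ hRB ⊢
  have hr0 : ∀ t x a, 0 ≤ φ x a ⬝ᵥ θ t := fun t x a => (hθ t x a).1
  have hr1 : ∀ t x a, φ x a ⬝ᵥ θ t ≤ 1 := fun t x a => (hθ t x a).2
  have hrm : ∀ t a, Measurable fun x => φ x a ⬝ᵥ θ t := fun t a =>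
    Finset.measurable_fun_sum _ fun i _ => (hφ_meas a i).mul_const _
  -- the estimated rewards
  let Z : ℕ → Ω → 𝒳 × 𝒜 := fun t ω => (X t ω, AB t ω)
  have hZm : ∀ t, Measurable (Z t) := fun t => (hX_meas t).prodMk (hAB_meas t)
  have hl : ∀ t x a ω, (∑ i, θhat t ω i * φ x a i) = lpL φ V θ t (Z t ω) x a := by
    intro t x a ω
    have e : (fun i => φ (X t ω) (AB t ω) i * RB t ω) = RB t ω • φ (X t ω) (AB t ω) := by
      funext i; simp [mul_comm]
    rw [hθhat, e, Matrix.mulVec_smul]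
    change (RB t ω • V⁻¹ *ᵥ φ (X t ω) (AB t ω)) ⬝ᵥ φ x a = _
    rw [smul_dotProduct, dotProduct_comm, hQs, hRB, smul_eq_mul, mul_comm]
    rfl
  have hlb : ∀ t z x a, |η * lpL φ V θ t z x a| ≤ 1 / 2 := by
    intro t z x a
    unfold lpL
    rw [← mul_assoc, abs_mul, abs_of_nonneg (hr0 t z.1 z.2)]
    calc _ ≤ |η * (φ z.1 z.2 ⬝ᵥ V⁻¹ *ᵥ φ x a)| * 1 := by gcongr; exact hr1 _ _ _
      _ ≤ 1 / 2 := by rw [mul_one]; exact hQb _ _ (hφB _ _) (hφB _ _)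
  -- history
  let H : (t : ℕ) → Ω → (Finset.range t → 𝒳 × 𝒜) := fun t ω k => Z k ω
  have hHm : ∀ t, Measurable (H t) := fun t => measurable_pi_lambda _ fun k => hZm k
  have hHZ : ∀ t, IndepFun (H t) (Z t) μ := by
    intro t
    have h := h_indep.indepFun_finset (Finset.range t) {t} (by simp) hZm
    have hm : Measurable fun g : (({t} : Finset ℕ) → 𝒳 × 𝒜) =>
        g ⟨t, Finset.mem_singleton_self t⟩ := by fun_prop
    exact h.comp measurable_id hm
  have hwW : ∀ t x a ω, w t x a ω = lpW φ V θ η t (H t ω) x a := by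
    intro t x a ω
    rw [hw, lpW, ← Finset.prod_coe_sort]
    refine Finset.prod_congr rfl fun k _ => ?_
    rw [hl]
  have hpP : ∀ t x a ω, pol t x a ω = lpP φ V θ η t (H t ω) x a := by
    intro t x a ω
    rw [hpol, lpP]
    simp_rw [hwW]
  have hWpos : ∀ t h x a, 0 < lpW φ V θ η t h x a := by
    intro t h x a
    refine Finset.prod_pos fun k _ => ?_
    have := (abs_le.1 (hlb k (h k) x a)).1
    linarith
  have hP0 : ∀ t h x a, 0 ≤ lpP φ V θ η t h x a := fun t h x a =>
    div_nonneg (hWpos t h x a).le (Finset.sum_nonneg fun a _ => (hWpos t h x a).le)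
  have hP1 : ∀ t h x a, lpP φ V θ η t h x a ≤ 1 := fun t h x a =>
    div_le_one_of_le₀ (Finset.single_le_sum (fun a _ => (hWpos t h x a).le) (Finset.mem_univ a))
      (Finset.sum_nonneg fun a _ => (hWpos t h x a).le)
  have hs1 : ∀ x a, πstar x a ≤ 1 := fun x a => by
    rw [← hπstar_sum x]
    exact Finset.single_le_sum (fun a _ => hπstar_nonneg x a) (Finset.mem_univ a)
  have hPm := lpP_meas φ hφ_meas V θ η
  have hLm := lpL_meas φ hφ_meas V θ
  have hdb : ∀ t h x a, |πstar x a - lpP φ V θ η t h x a| ≤ 1 := fun t h x a => by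
    rw [abs_le]
    constructor <;> linarith [hs1 x a, hP0 t h x a, hP1 t h x a, hπstar_nonneg x a]
  -- per-round regret function
  let G : (t : ℕ) → (Finset.range t → 𝒳 × 𝒜) × 𝒳 → ℝ := fun t p =>
    ∑ a, (πstar p.2 a - lpP φ V θ η t p.1 p.2 a) * (φ p.2 a ⬝ᵥ θ t)
  have hGm : ∀ t, Measurable (G t) := fun t =>
    Finset.measurable_fun_sum _ fun a _ =>
      (((hπstar_meas a).comp measurable_snd).sub (hPm t a)).mul ((hrm t a).comp measurable_snd)
  have hGb : ∀ t p, |G t p| ≤ Fintype.card 𝒜 := by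
    intro t p
    refine (Finset.abs_sum_le_sum_abs _ _).trans ?_
    refine (Finset.sum_le_card_nsmul _ _ 1 fun a _ => ?_).trans (by simp)
    rw [abs_mul, abs_of_nonneg (hr0 _ _ _)]
    exact mul_le_one₀ (hdb _ _ _ _) (hr0 _ _ _) (hr1 _ _ _)
  have hpm : ∀ t, Measurable fun q : Ω × 𝒳 => G t (H t q.1, q.2) := fun t =>
    (hGm t).comp (((hHm t).comp measurable_fst).prodMk measurable_snd)
  have hGint : ∀ t, Integrable (fun q : Ω × 𝒳 => G t (H t q.1, q.2)) (μ.prod ν) := fun t =>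
    lp_int _ (hpm t) _ fun q => hGb t _
  have hlaw := fun t => lp_law μ ν πB hπB_nonneg hπB_sum hπB_meas (X t) (AB t) (hX_meas t)
    (hAB_meas t) (h_law t)
  -- Step 1
  have step1 : (∫ ω, ∑ t ∈ Finset.range n, ∑ a,
        (πstar (X t ω) a - pol t (X t ω) a ω) * (φ (X t ω) a ⬝ᵥ θ t) ∂μ)
      = ∑ t ∈ Finset.range n, ∫ ω, ∫ x, G t (H t ω, x) ∂ν ∂μ := by
    have e : ∀ t ω, ∑ a, (πstar (X t ω) a - pol t (X t ω) a ω) * (φ (X t ω) a ⬝ᵥ θ t)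
        = G t (H t ω, X t ω) := by
      intro t ω
      simp only [G, hpP]
    simp_rw [e]
    have hGX : ∀ t, Integrable (fun ω => G t (H t ω, X t ω)) μ := fun t =>
      lp_int μ ((hGm t).comp ((hHm t).prodMk (hX_meas t))) _ fun ω => hGb t _
    rw [integral_finsetSum _ fun t _ => hGX t]
    refine Finset.sum_congr rfl fun t _ => ?_
    have hfm : Measurable fun p : (Finset.range t → 𝒳 × 𝒜) × (𝒳 × 𝒜) => G t (p.1, p.2.1) :=
      (hGm t).comp (measurable_fst.prodMk (measurable_fst.comp measurable_snd))
    refine (lp_indep μ (H t) (Z t) (hHm t) (hZm t) (hHZ t)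
      (fun p => G t (p.1, p.2.1)) hfm _ fun p => hGb t _).trans ?_
    refine integral_congr_ae (Filter.Eventually.of_forall fun ω => ?_)
    refine (hlaw t (fun z => G t (H t ω, z.1)) (hfm.comp measurable_prodMk_left) _
      fun z => hGb t _).trans ?_
    refine integral_congr_ae (Filter.Eventually.of_forall fun x => ?_)
    simp only
    rw [← Finset.sum_mul, hπB_sum, one_mul]
  rw [step1]
  have hlogK : 0 < Real.log K := Real.log_pos (by exact_mod_cast hK2)
  have hnpos : (0 : ℝ) < n := by exact_mod_cast hn
  obtain ⟨hCint, hCeq⟩ := lp_trace ν φ hφ_meas B hB πstar hπstar_nonneg hπstar_sum hπstar_meas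
    (Vbar πstar) (hVbar πstar) V⁻¹
  rw [← hCφ] at hCeq
  have hC0 : 0 ≤ Cφ := by
    rw [← hCeq]
    exact integral_nonneg fun x => Finset.sum_nonneg fun a _ =>
      mul_nonneg (hπstar_nonneg x a) (hQ0 _)
  rcases hC0.eq_or_lt with hC | hC
  · -- degenerate case
    rw [← hC]
    simp only [zero_mul, Real.sqrt_zero, mul_zero]
    have hae : ∀ᵐ x ∂ν, ∑ a, πstar x a * (φ x a ⬝ᵥ V⁻¹ *ᵥ φ x a) = 0 := by
      rw [← hC] at hCeq
      exact (integral_eq_zero_iff_of_nonneg (fun x => Finset.sum_nonneg fun a _ =>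
        mul_nonneg (hπstar_nonneg x a) (hQ0 _)) hCint).1 hCeq
    refine Finset.sum_nonpos fun t _ => integral_nonpos fun ω => integral_nonpos_of_ae ?_
    filter_upwards [hae] with x hx
    rw [Finset.sum_eq_zero_iff_of_nonneg fun a _ => mul_nonneg (hπstar_nonneg x a) (hQ0 _)] at hx
    refine Finset.sum_nonpos fun a _ => ?_
    have hz : πstar x a * (φ x a ⬝ᵥ θ t) = 0 := by
      rcases mul_eq_zero.1 (hx a (Finset.mem_univ a)) with h | h
      · simp [h]
      · -- Cauchy-Schwarz through the quadratic form
        have hc : ∀ s : ℝ, 0 ≤ (2 * s) * (φ x a ⬝ᵥ θ t) + s ^ 2 * (θ t ⬝ᵥ V *ᵥ θ t) := by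
          intro s
          have := hQ0 (φ x a + s • V *ᵥ θ t)
          simp only [Matrix.mulVec_add, Matrix.mulVec_smul, dotProduct_add, add_dotProduct,
            smul_dotProduct, dotProduct_smul, hVV', h, smul_eq_mul] at this
          rw [hQs (V *ᵥ θ t), hVV', dotProduct_comm (V *ᵥ θ t)] at this
          linarith
        have hb := hpsd (θ t)
        have hrr := hr0 t x a
        set b := θ t ⬝ᵥ V *ᵥ θ t
        set r := φ x a ⬝ᵥ θ t
        have := hc (-r / (b + 1))
        have h1 : 0 < b + 1 := by linarith
        have e : 2 * (-r / (b + 1)) * r + (-r / (b + 1)) ^ 2 * b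
            = -(r ^ 2 * (b + 2)) / (b + 1) ^ 2 := by
          field_simp; ring
        rw [e, le_div_iff₀ (by positivity)] at this
        have : r ^ 2 = 0 := by nlinarith [sq_nonneg r]
        have : r = 0 := by simpa using this
        simp [this]
    rw [sub_mul]
    simp only [hz]
    have := mul_nonneg (hP0 t (H t ω) x a) (hr0 t x a)
    linarith
  · have hηpos : 0 < η := by rw [hη]; exact Real.sqrt_pos.2 (by positivity)
    have hLb : ∀ t z x a, |lpL φ V θ t z x a| ≤ 1 / (2 * η) := by
      intro t z x a
      have := hlb t z x a
      rw [abs_mul, abs_of_pos hηpos] at this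
      rw [le_div_iff₀ (by positivity)]
      linarith
    -- moments of the estimator
    have hLm1 : ∀ t x a, Measurable fun z => lpL φ V θ t z x a := fun t x a =>
      (hLm t a).comp measurable_prodMk_right
    have hEL : ∀ t x a, ∫ ω, lpL φ V θ t (Z t ω) x a ∂μ = φ x a ⬝ᵥ θ t := by
      intro t x a
      refine (hlaw t (fun z => lpL φ V θ t z x a) (hLm1 t x a) _
        fun z => hLb t z x a).trans ?_
      refine (hmom (V⁻¹ *ᵥ φ x a) (θ t)).2.trans ?_
      rw [dotProduct_comm, hQs, hVV']
    have hEL2 : ∀ t x a, ∫ ω, lpL φ V θ t (Z t ω) x a ^ 2 ∂μ ≤ φ x a ⬝ᵥ V⁻¹ *ᵥ φ x a := by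
      intro t x a
      have hb2 : ∀ z, |lpL φ V θ t z x a ^ 2| ≤ (1 / (2 * η)) ^ 2 := fun z => by
        rw [abs_pow]; exact pow_le_pow_left₀ (abs_nonneg _) (hLb t z x a) 2
      rw [hlaw t (fun z => lpL φ V θ t z x a ^ 2) ((hLm1 t x a).pow_const 2) _ hb2]
      have h2 := hmom (V⁻¹ *ᵥ φ x a) (V⁻¹ *ᵥ φ x a)
      rw [hVV, dotProduct_comm (V⁻¹ *ᵥ φ x a)] at h2
      rw [← h2.2]
      refine integral_mono ?_ h2.1 fun x' => Finset.sum_le_sum fun a' _ => ?_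
      · refine integrable_finsetSum _ fun a' _ => lp_int ν ((hπB_meas a').mul
          (((hLm1 t x a).pow_const 2).comp measurable_prodMk_right)) ((1 / (2 * η)) ^ 2)
          fun x' => ?_
        rw [abs_mul, abs_of_nonneg (hπB_nonneg _ _)]
        have hle : πB x' a' ≤ 1 := by
          rw [← hπB_sum x']
          exact Finset.single_le_sum (fun a _ => hπB_nonneg x' a) (Finset.mem_univ a')
        calc _ ≤ 1 * |lpL φ V θ t (x', a') x a ^ 2| := by gcongr
          _ ≤ _ := by rw [one_mul]; exact hb2 _
      · refine mul_le_mul_of_nonneg_left ?_ (hπB_nonneg _ _)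
        simp only [lpL]
        rw [mul_pow, ← sq]
        exact mul_le_of_le_one_right (sq_nonneg _) (pow_le_one₀ (hr0 _ _ _) (hr1 _ _ _))
    -- Step 3: replace true rewards by estimates
    have hLω : ∀ t x a, Measurable fun ω => lpL φ V θ t (Z t ω) x a := fun t x a =>
      (hLm1 t x a).comp (hZm t)
    have hPω : ∀ t x a, Measurable fun ω => lpP φ V θ η t (H t ω) x a := fun t x a =>
      ((hPm t a).comp measurable_prodMk_right).comp (hHm t)
    have hGL : ∀ t x, Integrable (fun ω => ∑ a, (πstar x a - lpP φ V θ η t (H t ω) x a)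
        * lpL φ V θ t (Z t ω) x a) μ := fun t x =>
      integrable_finsetSum _ fun a _ => lp_int μ ((measurable_const.sub (hPω t x a)).mul (hLω t x a))
        (1 * (1 / (2 * η))) fun ω => by
          rw [abs_mul]
          exact mul_le_mul (hdb _ _ _ _) (hLb _ _ _ _) (abs_nonneg _) zero_le_one
    have step3 : ∀ t x, ∫ ω, G t (H t ω, x) ∂μ = ∫ ω, ∑ a,
        (πstar x a - lpP φ V θ η t (H t ω) x a) * lpL φ V θ t (Z t ω) x a ∂μ := by
      intro t x
      have hfm : Measurable fun p : (Finset.range t → 𝒳 × 𝒜) × (𝒳 × 𝒜) =>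
          ∑ a, (πstar x a - lpP φ V θ η t p.1 x a) * lpL φ V θ t p.2 x a :=
        Finset.measurable_fun_sum _ fun a _ => (measurable_const.sub
          (((hPm t a).comp measurable_prodMk_right).comp measurable_fst)).mul
          ((hLm1 t x a).comp measurable_snd)
      refine Eq.symm ((lp_indep μ (H t) (Z t) (hHm t) (hZm t) (hHZ t) _ hfm
        (Fintype.card 𝒜 * (1 * (1 / (2 * η)))) fun p => ?_).trans ?_)
      · refine (Finset.abs_sum_le_sum_abs _ _).trans ?_
        refine (Finset.sum_le_card_nsmul _ _ (1 * (1 / (2 * η))) fun a _ => ?_).trans (by simp)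
        rw [abs_mul]
        exact mul_le_mul (hdb _ _ _ _) (hLb _ _ _ _) (abs_nonneg _) zero_le_one
      · refine integral_congr_ae (Filter.Eventually.of_forall fun ω => ?_)
        simp only
        rw [integral_finsetSum _ fun a _ => (lp_int μ (hLω t x a) _
          fun ω => hLb t _ x a).const_mul _]
        refine Finset.sum_congr rfl fun a _ => ?_
        rw [integral_const_mul, hEL]
    -- Step 4: pathwise bound, integrated
    have hL2 : ∀ t x a, Integrable (fun ω => lpL φ V θ t (Z t ω) x a ^ 2) μ := fun t x a =>
      lp_int μ ((hLω t x a).pow_const 2) ((1 / (2 * η)) ^ 2) fun ω => by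
        rw [abs_pow]; exact pow_le_pow_left₀ (abs_nonneg _) (hLb t _ x a) 2
    have step4 : ∀ x, η * ∑ t ∈ Finset.range n, ∫ ω, G t (H t ω, x) ∂μ
        ≤ Real.log K + η ^ 2 * n * ∑ a, πstar x a * (φ x a ⬝ᵥ V⁻¹ *ᵥ φ x a) := by
      intro x
      simp_rw [step3]
      rw [← integral_finsetSum _ fun t _ => hGL t x, ← integral_const_mul]
      have hi2 : ∀ t, Integrable (fun ω => ∑ a, πstar x a * lpL φ V θ t (Z t ω) x a ^ 2) μ :=
        fun t => integrable_finsetSum _ fun a _ => (hL2 t x a).const_mul _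
      have hpath : ∀ ω, η * ∑ t ∈ Finset.range n, ∑ a,
          (πstar x a - lpP φ V θ η t (H t ω) x a) * lpL φ V θ t (Z t ω) x a
          ≤ Real.log K + η ^ 2 * ∑ t ∈ Finset.range n,
            ∑ a, πstar x a * lpL φ V θ t (Z t ω) x a ^ 2 := by
        intro ω
        have h := lp_prod n (fun t a => η * lpL φ V θ t (Z t ω) x a)
          (fun t a => hlb t _ x a) (πstar x) (hπstar_nonneg x) (hπstar_sum x)
          (fun t a => w t x a ω) (fun t a => by simp_rw [hw, hl])
        simp_rw [← hpol, hpP] at h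
        rw [← hK] at h
        simp_rw [Finset.mul_sum]
        refine (le_of_eq ?_).trans (h.trans (le_of_eq ?_))
        · exact Finset.sum_congr rfl fun t _ => Finset.sum_congr rfl fun a _ => by ring
        · congr 1
          exact Finset.sum_congr rfl fun t _ => Finset.sum_congr rfl fun a _ => by ring
      have hint2 := (integrable_finsetSum (Finset.range n) fun t _ => hi2 t).const_mul (η ^ 2)
      refine (integral_mono ((integrable_finsetSum _ fun t _ => hGL t x).const_mul η)
        ((integrable_const (Real.log K)).add hint2) hpath).trans ?_
      simp only [Pi.add_apply]
      rw [integral_add (integrable_const _) hint2, integral_const_mul,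
        integral_finsetSum _ fun t _ => hi2 t]
      simp only [integral_const, probReal_univ, smul_eq_mul, one_mul]
      rw [mul_assoc (η ^ 2)]
      gcongr
      calc _ ≤ ∑ t ∈ Finset.range n, ∑ a, πstar x a * (φ x a ⬝ᵥ V⁻¹ *ᵥ φ x a) := by
            refine Finset.sum_le_sum fun t _ => ?_
            rw [integral_finsetSum _ fun a _ => (hL2 t x a).const_mul _]
            refine Finset.sum_le_sum fun a _ => ?_
            rw [integral_const_mul]
            exact mul_le_mul_of_nonneg_left (hEL2 t x a) (hπstar_nonneg x a)
        _ = _ := by simp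
    -- Step 5
    have hGx : ∀ t, Integrable (fun x => ∫ ω, G t (H t ω, x) ∂μ) ν := fun t =>
      (hGint t).integral_prod_right
    have step5 : η * ∑ t ∈ Finset.range n, ∫ ω, ∫ x, G t (H t ω, x) ∂ν ∂μ
        ≤ Real.log K + η ^ 2 * n * Cφ := by
      have e : ∀ t, ∫ ω, ∫ x, G t (H t ω, x) ∂ν ∂μ = ∫ x, ∫ ω, G t (H t ω, x) ∂μ ∂ν :=
        fun t => integral_integral_swap (hGint t)
      simp_rw [e]
      rw [← integral_finsetSum _ fun t _ => hGx t, ← integral_const_mul]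
      refine (integral_mono ((integrable_finsetSum _ fun t _ => hGx t).const_mul η)
        ((integrable_const (Real.log K)).add (hCint.const_mul (η ^ 2 * n))) step4).trans ?_
      simp only [Pi.add_apply]
      rw [integral_add (integrable_const _) (hCint.const_mul _), integral_const_mul, hCeq]
      simp
    set s := Real.sqrt (Cφ * n * Real.log K) with hs
    have hCn : 0 < Cφ * n := by positivity
    have hηs : η = s / (Cφ * n) := by
      rw [hη, hs, eq_div_iff hCn.ne', ← Real.sqrt_sq hCn.le, ← Real.sqrt_mul (by positivity),
        Real.sqrt_sq hCn.le]
      congr 1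
      field_simp
    have hss : s ^ 2 = Cφ * n * Real.log K := Real.sq_sqrt (by positivity)
    have h1 : η * (n * Cφ) = s := by rw [hηs]; field_simp
    have h2 : η * s = Real.log K := by
      rw [hηs, div_mul_eq_mul_div, ← sq, hss]; field_simp
    refine le_of_mul_le_mul_left (step5.trans (le_of_eq ?_)) hηpos
    linear_combination (-1 : ℝ) * h2 + η * h1
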